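/- Let k = 2d for an integer d ≥ 2, let n ≥ 1 be an integer, and let ε ∈ (0, 1/4). Then there exists a threshold decision tree over ℝ^d with k leaves and depth k−1 whose induced clustering of X(n,ε,d) is exactly the partition C into the 2d ε-balls B_i^a. -/

import Mathlib

noncomputable section

attribute [local instance] Classical.propDecidable

/-- A threshold decision tree over `ℝ^d`: every internal node is labeled by a
coordinate index and a real threshold. -/
inductive TDT (d : ℕ) : Type
  | leaf : TDT d
  | node (r : Fin d) (θ : ℝ) (left right : TDT d) : TDT d

namespace TDT

/-- The number of leaves of a threshold decision tree. -/
def leaves {d : ℕ} : TDT d → ℕ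
  | leaf => 1
  | node _ _ l r => l.leaves + r.leaves

/-- The depth of a threshold decision tree: the maximum number of internal nodes
on a root-to-leaf path. -/
def depth {d : ℕ} : TDT d → ℕ
  | leaf => 0
  | node _ _ l r => max l.depth r.depth + 1

/-- The index (numbering leaves from left to right) of the leaf a point is routed to:
at a node labeled `(r, θ)` the point goes left when its `r`-th coordinate is `< θ`,
and right otherwise. -/
def route {d : ℕ} : TDT d → EuclideanSpace ℝ (Fin d) → ℕ
  | leaf, _ => 0
  | node r θ l rt, x => if x r < θ then l.route x else l.leaves + rt.route x

/-- The clustering of a finite multiset induced by a threshold decision tree: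
the partition of `X` into the nonempty fibers of `route` (points routed to the
same leaf form one cluster). -/
def clustering {d : ℕ} (t : TDT d) (X : Multiset (EuclideanSpace ℝ (Fin d))) :
    Multiset (Multiset (EuclideanSpace ℝ (Fin d))) :=
  Multiset.filter (fun C => C ≠ 0)
    ((Finset.range t.leaves).val.map fun i => X.filter fun x => t.route x = i)

end TDT

/-- `P` is a partition of the multiset `X` into at most `k` nonempty clusters. -/
def IsClustering {d : ℕ} (X : Multiset (EuclideanSpace ℝ (Fin d))) (k : ℕ)
    (P : Multiset (Multiset (EuclideanSpace ℝ (Fin d)))) : Prop :=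
  P.sum = X ∧ Multiset.card P ≤ k ∧ (0 : Multiset (EuclideanSpace ℝ (Fin d))) ∉ P

/-- The `1`-means cost of a single cluster: `inf_c Σ_{x ∈ C} ‖x - c‖²`. -/
def costMeans1 {d : ℕ} (C : Multiset (EuclideanSpace ℝ (Fin d))) : ℝ :=
  ⨅ c : EuclideanSpace ℝ (Fin d), (C.map fun x => ‖x - c‖ ^ 2).sum

/-- The k-means cost of a partition. -/
def costMeans {d : ℕ} (P : Multiset (Multiset (EuclideanSpace ℝ (Fin d)))) : ℝ :=
  (P.map costMeans1).sum

/-- The `1`-median cost of a single cluster: `inf_c Σ_{x ∈ C} ‖x - c‖`. -/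
def costMedian1 {d : ℕ} (C : Multiset (EuclideanSpace ℝ (Fin d))) : ℝ :=
  ⨅ c : EuclideanSpace ℝ (Fin d), (C.map fun x => ‖x - c‖).sum

/-- The k-median cost of a partition. -/
def costMedian {d : ℕ} (P : Multiset (Multiset (EuclideanSpace ℝ (Fin d)))) : ℝ :=
  (P.map costMedian1).sum

/-- The `1`-center cost of a single cluster: `inf_c max_{x ∈ C} ‖x - c‖`. -/
def costCenter1 {d : ℕ} (C : Multiset (EuclideanSpace ℝ (Fin d))) : ℝ :=
  ⨅ c : EuclideanSpace ℝ (Fin d), sSup ((fun x => ‖x - c‖) '' {x | x ∈ C})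

/-- The k-center cost of a partition: the maximum over clusters of the `1`-center cost. -/
def costCenter {d : ℕ} (P : Multiset (Multiset (EuclideanSpace ℝ (Fin d)))) : ℝ :=
  sSup (costCenter1 '' {C | C ∈ P})

/-- The optimal k-means cost of `X` over all partitions into at most `k` clusters. -/
def optMeans {d : ℕ} (X : Multiset (EuclideanSpace ℝ (Fin d))) (k : ℕ) : ℝ :=
  sInf {r : ℝ | ∃ P, IsClustering X k P ∧ r = costMeans P}

/-- The optimal k-median cost of `X` over all partitions into at most `k` clusters. -/
def optMedian {d : ℕ} (X : Multiset (EuclideanSpace ℝ (Fin d))) (k : ℕ) : ℝ :=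
  sInf {r : ℝ | ∃ P, IsClustering X k P ∧ r = costMedian P}

/-- The optimal k-center cost of `X` over all partitions into at most `k` clusters. -/
def optCenter {d : ℕ} (X : Multiset (EuclideanSpace ℝ (Fin d))) (k : ℕ) : ℝ :=
  sInf {r : ℝ | ∃ P, IsClustering X k P ∧ r = costCenter P}

/-! ### The high-dimensional point-set `X(n, ε, d)` -/

/-- The sign `1` or `-1` encoded by a boolean. -/
def sgn (b : Bool) : ℝ := if b then 1 else -1

/-- The point `a·e_i + ε·b·e_j` (with signs `a, b` encoded by booleans). -/
def hdPoint (d : ℕ) (ε : ℝ) (i j : Fin d) (a b : Bool) : EuclideanSpace ℝ (Fin d) :=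
  EuclideanSpace.single i (sgn a) + EuclideanSpace.single j (ε * sgn b)

/-- The ε-ball `B_i^a`: `n` copies of `a·e_i + ε·b·e_j` for all `j` and signs `b`. -/
def epsBall (n d : ℕ) (ε : ℝ) (i : Fin d) (a : Bool) : Multiset (EuclideanSpace ℝ (Fin d)) :=
  (Finset.univ : Finset (Fin d × Bool)).val.bind fun jb =>
    Multiset.replicate n (hdPoint d ε i jb.1 a jb.2)

/-- The partition `C` of `X(n, ε, d)` into the `2d` ε-balls `B_i^a`. -/
def XhdPartition (n d : ℕ) (ε : ℝ) : Multiset (Multiset (EuclideanSpace ℝ (Fin d))) :=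
  (Finset.univ : Finset (Fin d × Bool)).val.map fun ia => epsBall n d ε ia.1 ia.2

/-- The multiset `X(n, ε, d)`: `n` copies of `a·e_i + ε·b·e_j` for all `i, j ∈ [d]`,
`a, b ∈ {1, -1}`; it has `4nd²` points counted with multiplicity. -/
def Xhd (n d : ℕ) (ε : ℝ) : Multiset (EuclideanSpace ℝ (Fin d)) :=
  (XhdPartition n d ε).sum

/-! ### The weighted planar point-set `X(w, h)` -/

/-- A pair of reals viewed as a point of the Euclidean plane. -/
def toE2 (q : ℝ × ℝ) : EuclideanSpace ℝ (Fin 2) :=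
  (WithLp.equiv 2 (Fin 2 → ℝ)).symm ![q.1, q.2]

/-- `planarP h i = (p_i^1, p_i^2)`, the two points of the `i`-th cluster of the
weighted planar point-set `X(w, h)` (positions depend only on `h`). -/
def planarP (h : ℕ → ℝ) : ℕ → (ℝ × ℝ) × (ℝ × ℝ)
  | 0 => ((0, 0), (0, 0))
  | 1 => ((0, 0), (0, 0))
  | 2 => ((h 2, 0), (h 2, 0))
  | i + 3 =>
      let q := planarP h (i + 1)
      let q' := planarP h (i + 2)
      if (i + 3) % 2 = 1 then
        ((q.1.1 - 1, q.1.2 + h (i + 3)), (q'.2.1 + 1, q.2.2 + h (i + 3)))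
      else
        ((q.1.1 + h (i + 3), q.1.2 - 1), (q.2.1 + h (i + 3), q'.2.2 + 1))

/-- The position of the weighted point indexed by `(i, a) : Fin k × Fin 2`,
i.e. `p_{i+1}^{a+1}`. -/
def wpt (k : ℕ) (h : ℕ → ℝ) (x : Fin k × Fin 2) : EuclideanSpace ℝ (Fin 2) :=
  toE2 (if x.2 = (0 : Fin 2) then (planarP h ((x.1 : ℕ) + 1)).1
        else (planarP h ((x.1 : ℕ) + 1)).2)

/-- `P` is a partition of the index set of the `2k` weighted points into at most `k`
nonempty clusters. -/
def IsIdxPartition (k : ℕ) (P : Finset (Finset (Fin k × Fin 2))) : Prop :=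
  P.card ≤ k ∧ (∀ S ∈ P, S.Nonempty) ∧
    ∀ x : Fin k × Fin 2, ∃! S : Finset (Fin k × Fin 2), S ∈ P ∧ x ∈ S

/-- The weighted k-means cost of a partition of the index set of `X(w, h)`. -/
def wCostMeans (k : ℕ) (h w : ℕ → ℝ) (P : Finset (Finset (Fin k × Fin 2))) : ℝ :=
  ∑ S ∈ P, ⨅ c : EuclideanSpace ℝ (Fin 2),
    ∑ x ∈ S, w ((x.1 : ℕ) + 1) * ‖wpt k h x - c‖ ^ 2

/-- The weighted k-median cost of a partition of the index set of `X(w, h)`. -/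
def wCostMedian (k : ℕ) (h w : ℕ → ℝ) (P : Finset (Finset (Fin k × Fin 2))) : ℝ :=
  ∑ S ∈ P, ⨅ c : EuclideanSpace ℝ (Fin 2),
    ∑ x ∈ S, w ((x.1 : ℕ) + 1) * ‖wpt k h x - c‖

/-- The minimum weighted k-means cost over all partitions of the `2k` weighted points
into at most `k` clusters. -/
def wOptMeans (k : ℕ) (h w : ℕ → ℝ) : ℝ :=
  sInf {r : ℝ | ∃ P, IsIdxPartition k P ∧ r = wCostMeans k h w P}

/-- The minimum weighted k-median cost over all partitions of the `2k` weighted points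
into at most `k` clusters. -/
def wOptMedian (k : ℕ) (h w : ℕ → ℝ) : ℝ :=
  sInf {r : ℝ | ∃ P, IsIdxPartition k P ∧ r = wCostMedian k h w P}

/-- The canonical partition `C = (C_1, …, C_k)` of the index set, where
`C_i = {p_i^1, p_i^2}`. -/
def wCanonical (k : ℕ) : Finset (Finset (Fin k × Fin 2)) :=
  (Finset.univ : Finset (Fin k)).image fun i =>
    Finset.univ.filter fun x : Fin k × Fin 2 => x.1 = i

/-- The partition of the index set of the `2k` weighted points induced by a threshold
decision tree (nonempty fibers of the routing of the corresponding positions). -/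
def treeIdxPartition (k : ℕ) (t : TDT 2) (h : ℕ → ℝ) : Finset (Finset (Fin k × Fin 2)) :=
  Finset.filter (fun S => S.Nonempty)
    ((Finset.range t.leaves).image fun ℓ =>
      Finset.univ.filter fun x : Fin k × Fin 2 => t.route (wpt k h x) = ℓ)

/-! ### The planar point-set `Y_k` for k-center -/

/-- The four points of the first cluster of `Y_k`. -/
def Ybase1 : Fin 4 → ℝ × ℝ := ![(-1, 0), (-1.5, 0.5), (-1, 1), (-0.5, 0.5)]

/-- The four points of the second cluster of `Y_k`. -/
def Ybase2 : Fin 4 → ℝ × ℝ := ![(1, 0), (0.5, 0.5), (1, 1), (1.5, 0.5)]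

/-- `Ypt i a = p_i^{a+1}`, the `a`-th point of the `i`-th cluster of `Y_k`. -/
def Ypt : ℕ → Fin 4 → ℝ × ℝ
  | 0, _ => (0, 0)
  | 1, a => Ybase1 a
  | 2, a => Ybase2 a
  | 3, a => Ybase1 a + (1, 2)
  | 4, a => Ybase2 a + (2, 1)
  | i + 5, a => Ypt (i + 3) a + (2, 2)

/-- The cluster `C_i = {p_i^1, p_i^2, p_i^3, p_i^4}` of `Y_k`. -/
def Ycluster (i : ℕ) : Multiset (EuclideanSpace ℝ (Fin 2)) :=
  (Finset.univ : Finset (Fin 4)).val.map fun a => toE2 (Ypt i a)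

/-- The partition `C = (C_1, …, C_k)` of `Y_k`. -/
def Ypartition (k : ℕ) : Multiset (Multiset (EuclideanSpace ℝ (Fin 2))) :=
  (Finset.range k).val.map fun i => Ycluster (i + 1)

/-- The point-set `Y_k` (as a multiset of `4k` points in the plane). -/
def Yset (k : ℕ) : Multiset (EuclideanSpace ℝ (Fin 2)) := (Ypartition k).sum



/-- Along coordinate `i`, the points of `B_i^-` are the only ones below `-1/2`. -/
lemma hdPoint_lt_neg_half_iff {d : ℕ} {ε : ℝ} (hε : 0 < ε) (hε' : ε < 1 / 4)
    (i k j : Fin d) (a b : Bool) :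
    hdPoint d ε k j a b i < -(1 / 2) ↔ (k, a) = (i, false) := by
  rcases a <;> rcases b <;> by_cases h₁ : i = k <;> by_cases h₂ : i = j <;>
    simp [hdPoint, sgn, Prod.ext_iff, h₁, h₂, eq_comm] <;> grind

/-- Along coordinate `i`, the points of `B_i^+` are the only ones that reach `1/2`. -/
lemma hdPoint_lt_half_iff {d : ℕ} {ε : ℝ} (hε : 0 < ε) (hε' : ε < 1 / 4)
    (i k j : Fin d) (a b : Bool) :
    hdPoint d ε k j a b i < 1 / 2 ↔ (k, a) ≠ (i, true) := by
  rcases a <;> rcases b <;> by_cases h₁ : i = k <;> by_cases h₂ : i = j <;>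
    simp [hdPoint, sgn, Prod.ext_iff, h₁, h₂, eq_comm] <;> grind

/-- Any nonempty family of ε-balls is separated by a tree that cuts off one ball at a time. -/
lemma exists_tree_separating {d : ℕ} {ε : ℝ} (hε : 0 < ε) (hε' : ε < 1 / 4)
    (S : Finset (Fin d × Bool)) (hS : S.Nonempty) :
    ∃ (t : TDT d) (f : Fin d × Bool → ℕ), t.leaves = S.card ∧ t.depth = S.card - 1 ∧
      Set.InjOn f S ∧ (∀ p ∈ S, f p < S.card) ∧
      ∀ p ∈ S, ∀ j b, t.route (hdPoint d ε p.1 j p.2 b) = f p := by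
  induction hS using Finset.Nonempty.cons_induction with
  | singleton q => exact ⟨.leaf, fun _ => 0, by simp [TDT.leaves, TDT.depth, TDT.route]⟩
  | cons q S hq hS ih =>
    obtain ⟨t, f, hl, hd, hf, hlt, hr⟩ := ih
    have hpos := hS.card_pos
    obtain ⟨i, a⟩ := q
    cases a with
    | false =>
      refine ⟨.node i (-(1 / 2)) .leaf t, fun p => if p = (i, false) then 0 else 1 + f p,
        ?_, ?_, ?_, ?_, ?_⟩
      · simp only [TDT.leaves, hl, Finset.card_cons, add_comm]
      · simp only [TDT.depth, hd, Finset.card_cons]; omega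
      · intro p hp p' hp' h
        simp only [Finset.coe_cons, Set.mem_insert_iff, Finset.mem_coe] at hp hp'
        have := @hf p
        grind
      · intro p hp
        simp only [Finset.mem_cons, Finset.card_cons] at hp ⊢
        grind
      · intro p hp j b
        simp only [Finset.mem_cons] at hp
        simp only [TDT.route, hdPoint_lt_neg_half_iff hε hε', TDT.leaves]
        grind
    | true =>
      refine ⟨.node i (1 / 2) t .leaf, fun p => if p = (i, true) then S.card else f p,
        ?_, ?_, ?_, ?_, ?_⟩
      · simp only [TDT.leaves, hl, Finset.card_cons]
      · simp only [TDT.depth, hd, Finset.card_cons]; omega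
      · intro p hp p' hp' h
        simp only [Finset.coe_cons, Set.mem_insert_iff, Finset.mem_coe] at hp hp'
        have := @hf p
        grind
      · intro p hp
        simp only [Finset.mem_cons, Finset.card_cons] at hp ⊢
        grind
      · intro p hp j b
        simp only [Finset.mem_cons] at hp
        simp only [TDT.route, hdPoint_lt_half_iff hε hε']
        grind

lemma mem_epsBall {n d : ℕ} {ε : ℝ} {i : Fin d} {a : Bool} {x : EuclideanSpace ℝ (Fin d)}
    (hx : x ∈ epsBall n d ε i a) : ∃ j b, x = hdPoint d ε i j a b := by
  simp only [epsBall, Multiset.mem_bind] at hx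
  obtain ⟨jb, -, h⟩ := hx
  exact ⟨jb.1, jb.2, Multiset.eq_of_mem_replicate h⟩

lemma epsBall_ne_zero {n d : ℕ} (hn : 1 ≤ n) (ε : ℝ) (i : Fin d) (a : Bool) :
    epsBall n d ε i a ≠ 0 := by
  have : hdPoint d ε i i a a ∈ epsBall n d ε i a := by
    simp only [epsBall, Multiset.mem_bind]
    exact ⟨(i, a), Finset.mem_univ _, Multiset.mem_replicate.2 ⟨by omega, rfl⟩⟩
  exact fun h => by simp [h] at this

/-- If `g` takes the constant value `f p` on each block `B p` and `f` is injective, then the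
fibre of `g` over `f p` in the union of the blocks is `B p`. -/
lemma filter_sum_eq_block {ι α : Type*} [Fintype ι] (B : ι → Multiset α) (g : α → ℕ)
    (f : ι → ℕ) (hf : Function.Injective f) (hg : ∀ p, ∀ x ∈ B p, g x = f p) (p : ι) :
    (∑ q, B q).filter (fun x => g x = f p) = B p := by
  have hsum : (∑ q, B q).filter (fun x => g x = f p) =
      ∑ q, (B q).filter (fun x => g x = f p) :=
    map_sum (⟨⟨fun s => s.filter (fun x => g x = f p), Multiset.filter_zero _⟩,
      Multiset.filter_add _⟩ : Multiset α →+ Multiset α) B Finset.univ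
  rw [hsum, Finset.sum_eq_single p]
  · exact Multiset.filter_eq_self.2 (hg p)
  · intro q _ hqp
    refine Multiset.filter_eq_nil.2 fun x hx h => hqp (hf ?_)
    rw [← hg q x hx, h]
  · simp

/-- STATEMENT: there is a threshold decision tree with `2d` leaves and depth `2d - 1`
whose induced clustering of `X(n, ε, d)` is exactly the partition into the `2d` ε-balls. -/
theorem stmt_6 (d n : ℕ) (hd : 2 ≤ d) (hn : 1 ≤ n) (ε : ℝ) (hε : 0 < ε)
    (hε' : ε < 1 / 4) :
    ∃ t : TDT d, t.leaves = 2 * d ∧ t.depth = 2 * d - 1 ∧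
      t.clustering (Xhd n d ε) = XhdPartition n d ε := by
  have hcard : (Finset.univ : Finset (Fin d × Bool)).card = 2 * d := by
    simp [mul_comm]
  obtain ⟨t, f, hl, hdepth, hf, hlt, hr⟩ := exists_tree_separating hε hε' Finset.univ
    (Finset.card_pos.1 (by omega : 0 < (Finset.univ : Finset (Fin d × Bool)).card))
  rw [Finset.coe_univ, Set.injOn_univ] at hf
  have himage : Finset.range t.leaves = Finset.univ.map ⟨f, hf⟩ := by
    refine (Finset.eq_of_subset_of_card_le ?_ ?_).symm
    · intro m hm
      obtain ⟨p, hp, rfl⟩ := Finset.mem_map.1 hm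
      rw [Finset.mem_range, hl]
      exact hlt p hp
    · rw [Finset.card_range, Finset.card_map, hl]
  have hblock (p : Fin d × Bool) :
      (Xhd n d ε).filter (fun x => t.route x = f p) = epsBall n d ε p.1 p.2 := by
    have hg (q : Fin d × Bool) (x) (hx : x ∈ epsBall n d ε q.1 q.2) : t.route x = f q := by
      obtain ⟨j, b, rfl⟩ := mem_epsBall hx
      exact hr q (Finset.mem_univ q) j b
    have hX : Xhd n d ε = ∑ q : Fin d × Bool, epsBall n d ε q.1 q.2 := by
      rw [Xhd, XhdPartition, Finset.sum_eq_multiset_sum]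
    rw [hX]
    have h := filter_sum_eq_block (fun q : Fin d × Bool => epsBall n d ε q.1 q.2) t.route f hf
    exact h hg p
  refine ⟨t, hl.trans hcard, by rw [hdepth, hcard], ?_⟩
  have hmap : ((Finset.range t.leaves).val.map fun i =>
      (Xhd n d ε).filter fun x => t.route x = i) = XhdPartition n d ε := by
    rw [himage, Finset.map_val, Multiset.map_map]
    exact Multiset.map_congr rfl fun p _ => hblock p
  rw [TDT.clustering, hmap, Multiset.filter_eq_self]
  intro C hC
  obtain ⟨p, -, rfl⟩ := Multiset.mem_map.1 hC
  exact epsBall_ne_zero hn ε p.1 p.2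

end
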